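/- (Chandrasekhar-type commutation: mode-reduced spin-1 Teukolsky equation transforms to the Regge–Wheeler equation, eqs. (13)–(14).) Let λ ∈ ℝ and let α : ℝ × (2M,∞) → ℝ be smooth and satisfy the mode-reduced spin-1 Teukolsky equation ∂_t²α − R*(R*α) + (D/r²) λ α + (2/r)(1 − 3M/r)( ∂_tα − R*α ) = 0 on ℝ × (2M,∞). Define Z = (r²/D)( T − R* ), i.e. Zα = (r²/D)( ∂_tα − R*α ). Then φ := Zα satisfies the mode-reduced Regge–Wheeler equation ∂_t²φ − R*(R*φ) + (D/r²) λ φ = 0 on ℝ × (2M,∞); in particular, commuting with Z removes the first-order term entirely without producing any additional lower-order terms. -/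

import Mathlib

open MeasureTheory Set
open scoped ENNReal

noncomputable section

/-- `D(r) = 1 - 2M/r`. -/
def Dc (M r : ℝ) : ℝ := 1 - 2*M/r

/-- `f(r) = (1 - 3M/r) √(1 + 6M/r)`. -/
def fc (M r : ℝ) : ℝ := (1 - 3*M/r) * Real.sqrt (1 + 6*M/r)

/-- Partial derivative in `t`. -/
def pt (ψ : ℝ → ℝ → ℝ) : ℝ → ℝ → ℝ := fun t r => deriv (fun t' => ψ t' r) t

/-- Partial derivative in `r`. -/
def pr (ψ : ℝ → ℝ → ℝ) : ℝ → ℝ → ℝ := fun t r => deriv (fun r' => ψ t r') r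

/-- `R* = (2M/r) ∂_t + D ∂_r`. -/
def Rst (M : ℝ) (ψ : ℝ → ℝ → ℝ) : ℝ → ℝ → ℝ :=
  fun t r => (2*M/r) * pt ψ t r + Dc M r * pr ψ t r

/-- `W = (r/√D)(R* + f T)`. -/
def Wc (M : ℝ) (ψ : ℝ → ℝ → ℝ) : ℝ → ℝ → ℝ :=
  fun t r => (r / Real.sqrt (Dc M r)) * (Rst M ψ t r + fc M r * pt ψ t r)

/-- The mode-reduced Regge--Wheeler operator `P_{s,ℓ}`. -/
def Pc (M : ℝ) (s ℓ : ℕ) (ψ : ℝ → ℝ → ℝ) : ℝ → ℝ → ℝ := fun t r =>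
  (1 + 2*M/r) * pt (pt ψ) t r - (4*M/r) * pt (pr ψ) t r + (2*M/r^2) * pt ψ t r
    - pr (fun t' r' => Dc M r' * pr ψ t' r') t r
    + ((ℓ : ℝ)*((ℓ : ℝ)+1)/r^2) * ψ t r + (1 - (s : ℝ)^2) * (2*M/r^3) * ψ t r

/-- Slice energy `E[ψ](τ)` (degenerate at the horizon). -/
def eE (M : ℝ) (ℓ : ℕ) (ψ : ℝ → ℝ → ℝ) (τ : ℝ) : ℝ≥0∞ :=
  ∫⁻ r in Ioi (2*M), ENNReal.ofReal
    ((pt ψ τ r)^2 + Dc M r * (pr ψ τ r)^2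
      + (ℓ : ℝ)*((ℓ : ℝ)+1)*(ψ τ r)^2/r^2 + (ψ τ r)^2/r^2)

/-- Non-degenerate slice energy `Ē[ψ](τ)`. -/
def eEbar (M : ℝ) (ℓ : ℕ) (ψ : ℝ → ℝ → ℝ) (τ : ℝ) : ℝ≥0∞ :=
  ∫⁻ r in Ioi (2*M), ENNReal.ofReal
    ((pt ψ τ r)^2 + (pr ψ τ r)^2
      + (ℓ : ℝ)*((ℓ : ℝ)+1)*(ψ τ r)^2/r^2 + (ψ τ r)^2/r^2)

/-- Spacetime energy `I_ndeg[ψ](τ₁,τ₂)` (degenerate at the horizon). -/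
def iNdeg (M : ℝ) (ℓ : ℕ) (ψ : ℝ → ℝ → ℝ) (τ₁ τ₂ : ℝ) : ℝ≥0∞ :=
  ∫⁻ τ in Ioc τ₁ τ₂, ∫⁻ r in Ioi (2*M), ENNReal.ofReal
    ((pt ψ τ r)^2/r^2 + Dc M r * (pr ψ τ r)^2/r^2
      + (ℓ : ℝ)*((ℓ : ℝ)+1)*(ψ τ r)^2/r^3 + (ψ τ r)^2/r^3)

/-- Non-degenerate spacetime energy `Ī_ndeg[ψ](τ₁,τ₂)`. -/
def iNdegBar (M : ℝ) (ℓ : ℕ) (ψ : ℝ → ℝ → ℝ) (τ₁ τ₂ : ℝ) : ℝ≥0∞ :=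
  ∫⁻ τ in Ioc τ₁ τ₂, ∫⁻ r in Ioi (2*M), ENNReal.ofReal
    ((pt ψ τ r)^2/r^2 + (pr ψ τ r)^2/r^2
      + (ℓ : ℝ)*((ℓ : ℝ)+1)*(ψ τ r)^2/r^3 + (ψ τ r)^2/r^3)

/-- Spacetime energy `Ī_deg[ψ](τ₁,τ₂)` degenerating at the photon sphere `r = 3M`. -/
def iDegBar (M : ℝ) (ℓ : ℕ) (ψ : ℝ → ℝ → ℝ) (τ₁ τ₂ : ℝ) : ℝ≥0∞ :=
  ∫⁻ τ in Ioc τ₁ τ₂, ∫⁻ r in Ioi (2*M), ENNReal.ofReal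
    ((1 - 3*M/r)^2 * ((pt ψ τ r)^2/r^2 + (pr ψ τ r)^2/r^2
        + (ℓ : ℝ)*((ℓ : ℝ)+1)*(ψ τ r)^2/r^3)
      + (Rst M ψ τ r)^2/r^2 + (ψ τ r)^2/r^3)

/-- Smoothness of a two-variable function on `ℝ × S`. -/
def SmoothOnRegion (ψ : ℝ → ℝ → ℝ) (S : Set ℝ) : Prop :=
  ContDiffOn ℝ (⊤ : ℕ∞) (Function.uncurry ψ) (univ ×ˢ S)

/-- Compact support in `r` on every compact time interval. -/
def CompactRSupport (ψ : ℝ → ℝ → ℝ) : Prop :=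
  ∀ a b : ℝ, ∃ R : ℝ, ∀ t r : ℝ, t ∈ Icc a b → R ≤ r → ψ t r = 0

/-- The pointwise bounds (5) on the perturbation `β = (β^t, β^r)`. -/
def BetaBounds (M C : ℝ) (βt βr : ℝ → ℝ → ℝ) : Prop :=
  ∀ t r : ℝ, 2*M < r →
    r^2 * |βt t r| + r^2 * |βr t r|
      + r ^ ((3:ℝ)/2) * |Wc M βt t r| + r ^ ((3:ℝ)/2) * |Wc M βr t r| ≤ C

/-- `ψ` solves the mode-reduced perturbed Regge--Wheeler equation. -/
def SolvesPerturbedRW (M : ℝ) (s ℓ : ℕ) (ε : ℝ) (βt βr ψ : ℝ → ℝ → ℝ) : Prop :=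
  ∀ t r : ℝ, 2*M < r →
    Pc M s ℓ ψ t r = ε * (βt t r * pt ψ t r + βr t r * pr ψ t r)

section SliceDerivatives

variable {ψ χ : ℝ → ℝ → ℝ} {S : Set ℝ}

theorem SmoothOnRegion.contDiffAt (h : SmoothOnRegion ψ S) (hS : IsOpen S) (t : ℝ) {r : ℝ}
    (hr : r ∈ S) : ContDiffAt ℝ (⊤ : ℕ∞) (Function.uncurry ψ) (t, r) :=
  ContDiffOn.contDiffAt h ((isOpen_univ.prod hS).mem_nhds ⟨mem_univ t, hr⟩)

theorem hasDerivAt_slice_fst {f : ℝ × ℝ → ℝ} {t r : ℝ} (h : DifferentiableAt ℝ f (t, r)) :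
    HasDerivAt (fun t' => f (t', r)) (fderiv ℝ f (t, r) (1, 0)) t :=
  h.hasFDerivAt.comp_hasDerivAt t ((hasDerivAt_id t).prodMk (hasDerivAt_const t r))

theorem hasDerivAt_slice_snd {f : ℝ × ℝ → ℝ} {t r : ℝ} (h : DifferentiableAt ℝ f (t, r)) :
    HasDerivAt (fun r' => f (t, r')) (fderiv ℝ f (t, r) (0, 1)) r :=
  h.hasFDerivAt.comp_hasDerivAt r ((hasDerivAt_const r t).prodMk (hasDerivAt_id r))

theorem SmoothOnRegion.differentiableAt (h : SmoothOnRegion ψ S) (hS : IsOpen S) (t : ℝ) {r : ℝ}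
    (hr : r ∈ S) : DifferentiableAt ℝ (Function.uncurry ψ) (t, r) :=
  (h.contDiffAt hS t hr).differentiableAt (by simp)

theorem SmoothOnRegion.pt_eq (h : SmoothOnRegion ψ S) (hS : IsOpen S) (t : ℝ) {r : ℝ}
    (hr : r ∈ S) : pt ψ t r = fderiv ℝ (Function.uncurry ψ) (t, r) (1, 0) :=
  (hasDerivAt_slice_fst (h.differentiableAt hS t hr)).deriv

theorem SmoothOnRegion.pr_eq (h : SmoothOnRegion ψ S) (hS : IsOpen S) (t : ℝ) {r : ℝ}
    (hr : r ∈ S) : pr ψ t r = fderiv ℝ (Function.uncurry ψ) (t, r) (0, 1) :=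
  (hasDerivAt_slice_snd (h.differentiableAt hS t hr)).deriv

theorem SmoothOnRegion.hasDerivAt_pt (h : SmoothOnRegion ψ S) (hS : IsOpen S) (t : ℝ) {r : ℝ}
    (hr : r ∈ S) : HasDerivAt (fun t' => ψ t' r) (pt ψ t r) t := by
  rw [h.pt_eq hS t hr]
  exact hasDerivAt_slice_fst (h.differentiableAt hS t hr)

theorem SmoothOnRegion.hasDerivAt_pr (h : SmoothOnRegion ψ S) (hS : IsOpen S) (t : ℝ) {r : ℝ}
    (hr : r ∈ S) : HasDerivAt (fun r' => ψ t r') (pr ψ t r) r := by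
  rw [h.pr_eq hS t hr]
  exact hasDerivAt_slice_snd (h.differentiableAt hS t hr)

theorem SmoothOnRegion.fderiv_apply (h : SmoothOnRegion ψ S) (hS : IsOpen S) (v : ℝ × ℝ) :
    ContDiffOn ℝ (⊤ : ℕ∞) (fun p => fderiv ℝ (Function.uncurry ψ) p v) (univ ×ˢ S) :=
  (ContDiffOn.fderiv_of_isOpen h (isOpen_univ.prod hS) (by simp)).clm_apply contDiffOn_const

theorem SmoothOnRegion.pt (h : SmoothOnRegion ψ S) (hS : IsOpen S) :
    SmoothOnRegion (pt ψ) S :=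
  (h.fderiv_apply hS (1, 0)).congr fun p hp => h.pt_eq hS p.1 hp.2

theorem SmoothOnRegion.pr (h : SmoothOnRegion ψ S) (hS : IsOpen S) :
    SmoothOnRegion (pr ψ) S :=
  (h.fderiv_apply hS (0, 1)).congr fun p hp => h.pr_eq hS p.1 hp.2

theorem pt_congr (h : ∀ t, ∀ r ∈ S, ψ t r = χ t r) (t : ℝ) {r : ℝ} (hr : r ∈ S) :
    pt ψ t r = pt χ t r := by
  simp only [pt, h _ r hr]

theorem pr_congr (hS : IsOpen S) (h : ∀ t, ∀ r ∈ S, ψ t r = χ t r) (t : ℝ) {r : ℝ}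
    (hr : r ∈ S) : pr ψ t r = pr χ t r :=
  Filter.EventuallyEq.deriv_eq (Filter.eventually_of_mem (hS.mem_nhds hr) fun r' hr' => h t r' hr')

theorem SmoothOnRegion.pt_pr_comm (h : SmoothOnRegion ψ S) (hS : IsOpen S) (t : ℝ) {r : ℝ}
    (hr : r ∈ S) : _root_.pt (_root_.pr ψ) t r = _root_.pr (_root_.pt ψ) t r := by
  have hd : DifferentiableAt ℝ (fderiv ℝ (Function.uncurry ψ)) (t, r) :=
    ((h.contDiffAt hS t hr).fderiv_right (m := 1) (by norm_cast)).differentiableAt (by simp)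
  have hsymm : IsSymmSndFDerivAt ℝ (Function.uncurry ψ) (t, r) :=
    (h.contDiffAt hS t hr).isSymmSndFDerivAt (by simp; norm_cast)
  have h1 := hasDerivAt_slice_fst (hd.clm_apply (differentiableAt_const ((0, 1) : ℝ × ℝ)))
  have h2 := hasDerivAt_slice_snd (hd.clm_apply (differentiableAt_const ((1, 0) : ℝ × ℝ)))
  rw [pt_congr (χ := fun t r => fderiv ℝ (Function.uncurry ψ) (t, r) (0, 1))
      (fun t r hr => h.pr_eq hS t hr) t hr,
    pr_congr hS (χ := fun t r => fderiv ℝ (Function.uncurry ψ) (t, r) (1, 0))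
      (fun t r hr => h.pt_eq hS t hr) t hr]
  refine h1.deriv.trans (Eq.trans ?_ h2.deriv.symm)
  rw [fderiv_clm_apply hd (differentiableAt_const _), fderiv_clm_apply hd (differentiableAt_const _)]
  simpa using hsymm (1, 0) (0, 1)

theorem SmoothOnRegion.add (h : SmoothOnRegion ψ S) (h' : SmoothOnRegion χ S) :
    SmoothOnRegion (fun t r => ψ t r + χ t r) S :=
  ContDiffOn.add h h'

theorem SmoothOnRegion.sub (h : SmoothOnRegion ψ S) (h' : SmoothOnRegion χ S) :
    SmoothOnRegion (fun t r => ψ t r - χ t r) S :=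
  ContDiffOn.sub h h'

theorem SmoothOnRegion.radial_mul {w : ℝ → ℝ} (hw : ContDiffOn ℝ (⊤ : ℕ∞) w S)
    (h : SmoothOnRegion ψ S) : SmoothOnRegion (fun t r => w r * ψ t r) S :=
  ContDiffOn.mul (hw.comp contDiffOn_snd fun _ hp => hp.2) h

end SliceDerivatives

section Exterior

variable {M : ℝ} {ψ χ : ℝ → ℝ → ℝ}

theorem ne_zero_of_mem_exterior (hM : 0 < M) {r : ℝ} (hr : r ∈ Ioi (2 * M)) : r ≠ 0 := by
  rw [mem_Ioi] at hr
  linarith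

theorem Dc_ne_zero (hM : 0 < M) {r : ℝ} (hr : r ∈ Ioi (2 * M)) : Dc M r ≠ 0 := by
  have h0 := ne_zero_of_mem_exterior hM hr
  rw [Dc, Ne, sub_eq_zero, eq_comm, div_eq_one_iff_eq h0]
  exact (mem_Ioi.1 hr).ne

theorem contDiffOn_two_mul_div (hM : 0 < M) :
    ContDiffOn ℝ (⊤ : ℕ∞) (fun r => 2 * M / r) (Ioi (2 * M)) :=
  contDiffOn_const.div contDiffOn_id fun _ hr => ne_zero_of_mem_exterior hM hr

theorem contDiffOn_Dc (hM : 0 < M) : ContDiffOn ℝ (⊤ : ℕ∞) (Dc M) (Ioi (2 * M)) :=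
  contDiffOn_const.sub (contDiffOn_two_mul_div hM)

theorem hasDerivAt_Dc (M : ℝ) {r : ℝ} (hr : r ≠ 0) : HasDerivAt (Dc M) (2 * M / r ^ 2) r := by
  have h := ((hasDerivAt_const r (2 * M)).div (hasDerivAt_id r) hr).const_sub 1
  refine h.congr_deriv ?_
  simp [neg_div]

theorem SmoothOnRegion.Rst (hM : 0 < M) (h : SmoothOnRegion ψ (Ioi (2 * M))) :
    SmoothOnRegion (Rst M ψ) (Ioi (2 * M)) :=
  ((h.pt isOpen_Ioi).radial_mul (contDiffOn_two_mul_div hM)).add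
    ((h.pr isOpen_Ioi).radial_mul (contDiffOn_Dc hM))

theorem Rst_congr (h : ∀ t, ∀ r ∈ Ioi (2 * M), ψ t r = χ t r) (t : ℝ) {r : ℝ}
    (hr : r ∈ Ioi (2 * M)) : Rst M ψ t r = Rst M χ t r := by
  rw [Rst, Rst, pt_congr h t hr, pr_congr isOpen_Ioi h t hr]

theorem pt_Rst_comm (h : SmoothOnRegion ψ (Ioi (2 * M))) (t : ℝ) {r : ℝ}
    (hr : r ∈ Ioi (2 * M)) : pt (Rst M ψ) t r = Rst M (pt ψ) t r := by
  rw [Rst, ← h.pt_pr_comm isOpen_Ioi t hr]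
  exact ((((h.pt isOpen_Ioi).hasDerivAt_pt isOpen_Ioi t hr).const_mul _).add
    (((h.pr isOpen_Ioi).hasDerivAt_pt isOpen_Ioi t hr).const_mul _)).deriv

theorem pt_add_Rst_radial_mul {w : ℝ → ℝ} {w' t r : ℝ} (h : SmoothOnRegion ψ (Ioi (2 * M)))
    (hr : r ∈ Ioi (2 * M)) (hw : HasDerivAt w w' r) :
    pt (fun t r => w r * ψ t r) t r + Rst M (fun t r => w r * ψ t r) t r
      = w r * (pt ψ t r + Rst M ψ t r) + Dc M r * w' * ψ t r := by
  have h1 : pt (fun t r => w r * ψ t r) t r = w r * pt ψ t r :=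
    ((h.hasDerivAt_pt isOpen_Ioi t hr).const_mul (w r)).deriv
  have h2 : pr (fun t r => w r * ψ t r) t r = w' * ψ t r + w r * pr ψ t r :=
    (hw.mul (h.hasDerivAt_pr isOpen_Ioi t hr)).deriv
  rw [Rst, Rst, h1, h2]
  ring

/-- `T² - R*² = (T - R*)(T + R*)`. -/
theorem wave_eq_outer_sub (hM : 0 < M) (h : SmoothOnRegion ψ (Ioi (2 * M))) (t : ℝ) {r : ℝ}
    (hr : r ∈ Ioi (2 * M)) :
    pt (pt ψ) t r - Rst M (Rst M ψ) t r
      = pt (fun t r => pt ψ t r + Rst M ψ t r) t r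
        - Rst M (fun t r => pt ψ t r + Rst M ψ t r) t r := by
  have hp := h.pt isOpen_Ioi
  have hR := h.Rst hM
  have h1 : pt (fun t r => pt ψ t r + Rst M ψ t r) t r = pt (pt ψ) t r + pt (Rst M ψ) t r :=
    ((hp.hasDerivAt_pt isOpen_Ioi t hr).add (hR.hasDerivAt_pt isOpen_Ioi t hr)).deriv
  have h2 : pr (fun t r => pt ψ t r + Rst M ψ t r) t r = pr (pt ψ) t r + pr (Rst M ψ) t r :=
    ((hp.hasDerivAt_pr isOpen_Ioi t hr).add (hR.hasDerivAt_pr isOpen_Ioi t hr)).deriv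
  have h3 := pt_Rst_comm h t hr
  rw [Rst, Rst, h1, h2]
  rw [Rst] at h3
  linear_combination (-1 : ℝ) * h3

/-- `T² - R*² = (T + R*)(T - R*)`. -/
theorem wave_eq_outer_add (hM : 0 < M) (h : SmoothOnRegion ψ (Ioi (2 * M))) (t : ℝ) {r : ℝ}
    (hr : r ∈ Ioi (2 * M)) :
    pt (pt ψ) t r - Rst M (Rst M ψ) t r
      = pt (fun t r => pt ψ t r - Rst M ψ t r) t r
        + Rst M (fun t r => pt ψ t r - Rst M ψ t r) t r := by
  have hp := h.pt isOpen_Ioi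
  have hR := h.Rst hM
  have h1 : pt (fun t r => pt ψ t r - Rst M ψ t r) t r = pt (pt ψ) t r - pt (Rst M ψ) t r :=
    ((hp.hasDerivAt_pt isOpen_Ioi t hr).sub (hR.hasDerivAt_pt isOpen_Ioi t hr)).deriv
  have h2 : pr (fun t r => pt ψ t r - Rst M ψ t r) t r = pr (pt ψ) t r - pr (Rst M ψ) t r :=
    ((hp.hasDerivAt_pr isOpen_Ioi t hr).sub (hR.hasDerivAt_pr isOpen_Ioi t hr)).deriv
  have h3 := pt_Rst_comm h t hr
  rw [Rst, Rst, h1, h2]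
  rw [Rst] at h3
  linear_combination h3

end Exterior

/-- **Eqs. (13)–(14): Chandrasekhar-type commutation.** If `α` solves the mode-reduced
spin-1 Teukolsky equation, then `Zα = (r²/D)(Tα − R*α)` solves the mode-reduced
Regge--Wheeler equation, with no lower-order terms produced. -/
theorem chandrasekhar_commutation (M : ℝ) (hM : 0 < M) (lam : ℝ)
    (α : ℝ → ℝ → ℝ) (hα : SmoothOnRegion α (Ioi (2*M)))
    (hTeuk : ∀ t r : ℝ, 2*M < r →
      pt (pt α) t r - Rst M (Rst M α) t r + (Dc M r / r^2) * lam * α t r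
        + (2/r) * (1 - 3*M/r) * (pt α t r - Rst M α t r) = 0) :
    ∀ t r : ℝ, 2*M < r →
      pt (pt (fun t' r' => (r'^2 / Dc M r') * (pt α t' r' - Rst M α t' r'))) t r
        - Rst M (Rst M (fun t' r' => (r'^2 / Dc M r') * (pt α t' r' - Rst M α t' r'))) t r
        + (Dc M r / r^2) * lam *
            ((r^2 / Dc M r) * (pt α t r - Rst M α t r)) = 0 := by
  have hβ : SmoothOnRegion (fun t r => pt α t r - Rst M α t r) (Ioi (2 * M)) :=
    (hα.pt isOpen_Ioi).sub (hα.Rst hM)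
  have hw : ContDiffOn ℝ (⊤ : ℕ∞) (fun r => r ^ 2 / Dc M r) (Ioi (2 * M)) :=
    (contDiffOn_id.pow 2).div (contDiffOn_Dc hM) fun r hr => Dc_ne_zero hM hr
  have hφ := hβ.radial_mul hw
  have outgoing : ∀ t, ∀ r ∈ Ioi (2 * M),
      pt (fun t r => r ^ 2 / Dc M r * (pt α t r - Rst M α t r)) t r
        + Rst M (fun t r => r ^ 2 / Dc M r * (pt α t r - Rst M α t r)) t r = -lam * α t r := by
    intro t r hr
    have hr0 := ne_zero_of_mem_exterior hM hr
    have hD := Dc_ne_zero hM hr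
    have hT := hTeuk t r hr
    rw [wave_eq_outer_add hM hα t hr] at hT
    rw [pt_add_Rst_radial_mul (w := fun r => r ^ 2 / Dc M r) hβ hr
      ((hasDerivAt_pow 2 r).div (hasDerivAt_Dc M hr0) hD)]
    have hcoef : Dc M r * (((2 : ℕ) * r ^ (2 - 1) * Dc M r - r ^ 2 * (2 * M / r ^ 2)) / Dc M r ^ 2)
        = r ^ 2 / Dc M r * ((2 / r) * (1 - 3 * M / r)) := by
      field_simp
      simp only [Dc]
      field_simp
      push_cast
      ring
    rw [hcoef]
    have hinv : r ^ 2 / Dc M r * (Dc M r / r ^ 2) = 1 := by field_simp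
    linear_combination r ^ 2 / Dc M r * hT - lam * α t r * hinv
  intro t r hr
  have hr0 := ne_zero_of_mem_exterior hM hr
  have hD := Dc_ne_zero hM hr
  have h1 : pt (fun t r => -lam * α t r) t r = -lam * pt α t r :=
    ((hα.hasDerivAt_pt isOpen_Ioi t hr).const_mul (-lam)).deriv
  have h2 : pr (fun t r => -lam * α t r) t r = -lam * pr α t r :=
    ((hα.hasDerivAt_pr isOpen_Ioi t hr).const_mul (-lam)).deriv
  have hinv : Dc M r / r ^ 2 * (r ^ 2 / Dc M r) = 1 := by field_simp
  rw [wave_eq_outer_sub hM hφ t hr, pt_congr outgoing t hr, Rst_congr outgoing t hr,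
    Rst, h1, h2, Rst]
  linear_combination lam * (pt α t r - (2 * M / r * pt α t r + Dc M r * pr α t r)) * hinv
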